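/- Let φ be a CNF formula with clauses c₁, …, c_m over Boolean variables v₁, …, v_n. Define the prime event structure L_φ as follows: its events are t_i and f_i for each 1 ≤ i ≤ n together with d_j for each 1 ≤ j ≤ m; the causality relation is empty; and the conflict relation is the smallest symmetric relation such that t_i # f_i for every i, d_j # t_i whenever v_i occurs positively in clause c_j, and d_j # f_i whenever v_i occurs negatively in clause c_j. Let U be the set of all events of L_φ and D := {d₁, …, d_m}. Then φ is satisfiable if and only if there exists an alternative J to D after the empty configuration in U. -/

import Mathlib

/-- A configuration of a prime event structure: causally closed and conflict-free. -/
def IsConfig {E : Type*} (lt cfl : E → E → Prop) (C : Set E) : Prop :=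
  (∀ e ∈ C, ∀ e', lt e' e → e' ∈ C) ∧ ∀ e ∈ C, ∀ e' ∈ C, ¬ cfl e e'

/-- A clue to D after C in U: a configuration J ⊆ U such that C ∪ J is a
configuration and D ∩ J = ∅. -/
def Clue {E : Type*} (lt cfl : E → E → Prop) (U C D J : Set E) : Prop :=
  IsConfig lt cfl J ∧ J ⊆ U ∧ IsConfig lt cfl (C ∪ J) ∧ D ∩ J = ∅

/-- An alternative to D after C in U: a clue J such that every event of D is in
conflict with some event of J. -/
def AltTo {E : Type*} (lt cfl : E → E → Prop) (U C D J : Set E) : Prop :=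
  Clue lt cfl U C D J ∧ ∀ e ∈ D, ∃ e' ∈ J, cfl e e'

/-- Events of the PES L_φ: t_i and f_i for each variable v_i, d_j for each clause c_j. -/
inductive Ev10 (n m : ℕ) where
  | t : Fin n → Ev10 n m
  | f : Fin n → Ev10 n m
  | d : Fin m → Ev10 n m

/-- The conflict relation of L_φ: the smallest symmetric relation with t_i # f_i,
d_j # t_i when v_i occurs positively in c_j, and d_j # f_i when v_i occurs
negatively in c_j. -/
def cfl10 {n m : ℕ} (pos neg : Fin m → Finset (Fin n)) :
    Ev10 n m → Ev10 n m → Prop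
  | .t i, .f i' => i = i'
  | .f i, .t i' => i = i'
  | .t i, .d j => i ∈ pos j
  | .d j, .t i => i ∈ pos j
  | .f i, .d j => i ∈ neg j
  | .d j, .f i => i ∈ neg j
  | _, _ => False

/-- A CNF formula φ (clause c_j has positive literals pos j and negative literals
neg j) is satisfiable iff there exists an alternative J to D = {d₁, …, d_m} after
the empty configuration in the set U of all events of L_φ (causality is empty). -/
theorem stmt10 {n m : ℕ} (pos neg : Fin m → Finset (Fin n)) :
    (∃ a : Fin n → Bool, ∀ j : Fin m,
        (∃ i ∈ pos j, a i = true) ∨ (∃ i ∈ neg j, a i = false)) ↔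
      ∃ J : Set (Ev10 n m),
        AltTo (fun _ _ => False) (cfl10 pos neg) Set.univ ∅
          {e | ∃ j : Fin m, e = Ev10.d j} J := by
  classical
  constructor
  · rintro ⟨a, ha⟩
    have hconf : IsConfig (fun _ _ => False) (cfl10 pos neg)
        {e | (∃ i, e = Ev10.t i ∧ a i = true) ∨ ∃ i, e = Ev10.f i ∧ a i = false} := by
      refine ⟨fun _ _ _ h => h.elim, ?_⟩
      rintro _ (⟨i, rfl, hi⟩ | ⟨i, rfl, hi⟩) _ (⟨k, rfl, hk⟩ | ⟨k, rfl, hk⟩) h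
      · exact h
      · obtain rfl : i = k := h
        simp [hi] at hk
      · obtain rfl : i = k := h
        simp [hi] at hk
      · exact h
    refine ⟨_, ⟨hconf, Set.subset_univ _, by rwa [Set.empty_union], ?_⟩, ?_⟩
    · ext e
      simp only [Set.mem_inter_iff, Set.mem_ofPred_eq, Set.mem_empty_iff_false, iff_false]
      rintro ⟨⟨j, rfl⟩, ⟨i, h, -⟩ | ⟨i, h, -⟩⟩ <;> cases h
    · rintro _ ⟨j, rfl⟩
      obtain ⟨i, hi, hai⟩ | ⟨i, hi, hai⟩ := ha j
      · exact ⟨.t i, Or.inl ⟨i, rfl, hai⟩, hi⟩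
      · exact ⟨.f i, Or.inr ⟨i, rfl, hai⟩, hi⟩
  · rintro ⟨J, ⟨⟨-, hfree⟩, -, -, -⟩, halt⟩
    refine ⟨fun i => decide (Ev10.t i ∈ J), fun j => ?_⟩
    obtain ⟨e, he, hc⟩ := halt (.d j) ⟨j, rfl⟩
    cases e with
    | t i => exact Or.inl ⟨i, hc, decide_eq_true he⟩
    | f i => exact Or.inr ⟨i, hc, decide_eq_false fun ht => hfree _ ht _ he rfl⟩
    | d k => exact hc.elim
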